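/- arXiv:1407.8474 — 4 statements merged into one kernel-verified Lean document; each statement's English description precedes it below -/
import Mathlib

section
/- Let X be a finite set with a weight function w : X → ℝ≥0, extended to subsets by w(A) = Σ_{x∈A} w(x), let 𝒮 be a nonempty finite family of subsets of X, and let k ≥ 1 be an integer. Let OPT = max{ w(A₁ ∪ … ∪ A_k) : A₁,…,A_k ∈ 𝒮 }. Suppose T₁,…,T_k ∈ 𝒮 is a greedy sequence, i.e., for each i, T_{i+1} maximizes w(A ∖ (T₁ ∪ … ∪ T_i)) over all A ∈ 𝒮. Then w(T₁ ∪ … ∪ T_k) ≥ (1 − 1/e)·OPT, where e is Euler's number. -/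
open Finset

/-- The union of the first `i` sets chosen by the greedy algorithm
(`T j` for indices `j` with `(j : ℕ) < i`). -/
def prefixUnion {α : Type*} [DecidableEq α] {k : ℕ} (T : Fin k → Finset α) (i : ℕ) :
    Finset α :=
  (Finset.univ.filter (fun j : Fin k => (j : ℕ) < i)).biUnion T

theorem prefixUnion_zero {α : Type*} [DecidableEq α] {k : ℕ} (T : Fin k → Finset α) :
    prefixUnion T 0 = ∅ := by
  simp [prefixUnion]

theorem prefixUnion_succ {α : Type*} [DecidableEq α] {k : ℕ} (T : Fin k → Finset α)
    (i : Fin k) : prefixUnion T (i + 1) = prefixUnion T i ∪ T i := by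
  ext x
  simp only [prefixUnion, mem_biUnion, mem_filter, mem_univ, true_and, mem_union]
  constructor
  · rintro ⟨j, hj, hx⟩
    rcases Nat.lt_succ_iff_lt_or_eq.mp hj with h | h
    · exact Or.inl ⟨j, h, hx⟩
    · exact Or.inr (Fin.ext h ▸ hx)
  · rintro (⟨j, hj, hx⟩ | hx)
    · exact ⟨j, by omega, hx⟩
    · exact ⟨i, by omega, hx⟩

theorem prefixUnion_length {α : Type*} [DecidableEq α] {k : ℕ} (T : Fin k → Finset α) :
    prefixUnion T k = Finset.univ.biUnion T := by
  simp [prefixUnion]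

theorem sum_biUnion_le_sum_sum {ι α : Type*} [DecidableEq α] {w : α → ℝ} (hw : ∀ x, 0 ≤ w x)
    (s : Finset ι) (A : ι → Finset α) :
    ∑ x ∈ s.biUnion A, w x ≤ ∑ i ∈ s, ∑ x ∈ A i, w x := by
  classical
  induction s using Finset.induction_on with
  | empty => simp
  | insert a s ha ih =>
    rw [biUnion_insert, sum_insert ha, ← union_sdiff_self_eq_union,
      sum_union disjoint_sdiff]
    gcongr
    exact (sum_le_sum_of_subset_of_nonneg sdiff_subset fun x _ _ => hw x).trans ih

/-- If every `A j` gains at most as much weight over `P` as `S` does, then adding `S` to `P` closes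
at least a `1 / k` fraction of the gap to the weight of the union of the `A j`. -/
theorem sum_biUnion_sub_le_mul_gain {α : Type*} [DecidableEq α] {w : α → ℝ} (hw : ∀ x, 0 ≤ w x)
    {k : ℕ} (A : Fin k → Finset α) (P S : Finset α)
    (h : ∀ j, ∑ x ∈ A j \ P, w x ≤ ∑ x ∈ S \ P, w x) :
    ∑ x ∈ Finset.univ.biUnion A, w x - ∑ x ∈ P, w x ≤
      k * (∑ x ∈ P ∪ S, w x - ∑ x ∈ P, w x) := by
  have hgain : ∑ x ∈ P ∪ S, w x - ∑ x ∈ P, w x = ∑ x ∈ S \ P, w x := by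
    rw [← union_sdiff_self_eq_union, sum_union disjoint_sdiff, add_sub_cancel_left]
  have hcover : Finset.univ.biUnion A ⊆ P ∪ Finset.univ.biUnion (fun j => A j \ P) := by
    intro x hx
    by_cases hxP : x ∈ P <;> simp_all
  have hdisj : Disjoint P (Finset.univ.biUnion fun j => A j \ P) := by
    simp [disjoint_biUnion_right, disjoint_sdiff]
  calc ∑ x ∈ Finset.univ.biUnion A, w x - ∑ x ∈ P, w x
      ≤ ∑ x ∈ P ∪ Finset.univ.biUnion (fun j => A j \ P), w x - ∑ x ∈ P, w x :=
        sub_le_sub_right (sum_le_sum_of_subset_of_nonneg hcover fun x _ _ => hw x) _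
    _ = ∑ x ∈ Finset.univ.biUnion (fun j => A j \ P), w x := by
        rw [sum_union hdisj, add_sub_cancel_left]
    _ ≤ ∑ j, ∑ x ∈ A j \ P, w x := sum_biUnion_le_sum_sum hw _ _
    _ ≤ ∑ _j : Fin k, ∑ x ∈ S \ P, w x := sum_le_sum fun j _ => h j
    _ = k * (∑ x ∈ P ∪ S, w x - ∑ x ∈ P, w x) := by simp [hgain]

theorem gap_le_one_sub_inv_pow_mul {k : ℕ} (hk : 1 ≤ k) {f : ℕ → ℝ} {c : ℝ} (h0 : f 0 = 0)
    (hstep : ∀ i < k, c - f i ≤ k * (f (i + 1) - f i)) :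
    ∀ i ≤ k, c - f i ≤ (1 - 1 / (k : ℝ)) ^ i * c := by
  have hk' : (1 : ℝ) ≤ k := by exact_mod_cast hk
  have hk0 : (0 : ℝ) < k := by linarith
  have hratio : 0 ≤ 1 - 1 / (k : ℝ) := by
    rw [sub_nonneg, div_le_one hk0]
    exact hk'
  intro i
  induction i with
  | zero => simp [h0]
  | succ i ih =>
    intro hi
    have hdiv : (c - f i) / k ≤ f (i + 1) - f i := by
      rw [div_le_iff₀' hk0]
      exact hstep i hi
    calc c - f (i + 1) ≤ (c - f i) - (c - f i) / k := by linarith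
      _ = (1 - 1 / (k : ℝ)) * (c - f i) := by ring
      _ ≤ (1 - 1 / (k : ℝ)) * ((1 - 1 / (k : ℝ)) ^ i * c) :=
        mul_le_mul_of_nonneg_left (ih (by omega)) hratio
      _ = (1 - 1 / (k : ℝ)) ^ (i + 1) * c := by ring

/-- **Greedy approximation for Weighted Maximum Coverage, `1 - 1/e` form.**
Let `X` be a finite universe with nonnegative weights `w`, `𝒮` a nonempty family of
subsets, and `k ≥ 1`.  If `T 0, …, T (k-1) ∈ 𝒮` is a greedy sequence (each `T i`
maximizes the weight of newly covered elements over all members of `𝒮`), then the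
weight covered by the greedy sets is at least `(1 - 1/e)` times the weight covered by
any choice of `k` sets from `𝒮` — in particular at least `(1 - 1/e) · OPT`. -/
theorem greedy_wmcp_one_sub_inv_exp
    {α : Type*} [DecidableEq α] (w : α → NNReal)
    (𝒮 : Finset (Finset α)) (h𝒮 : 𝒮.Nonempty)
    (k : ℕ) (hk : 1 ≤ k)
    (T : Fin k → Finset α) (hT : ∀ i, T i ∈ 𝒮)
    (hgreedy : ∀ i : Fin k, ∀ A ∈ 𝒮,
      ∑ x ∈ A \ prefixUnion T (i : ℕ), (w x : ℝ) ≤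
        ∑ x ∈ T i \ prefixUnion T (i : ℕ), (w x : ℝ))
    (A : Fin k → Finset α) (hA : ∀ i, A i ∈ 𝒮) :
    (1 - 1 / Real.exp 1) * ∑ x ∈ Finset.univ.biUnion A, (w x : ℝ) ≤
      ∑ x ∈ Finset.univ.biUnion T, (w x : ℝ) := by
  have hw : ∀ x, (0 : ℝ) ≤ w x := fun x => (w x).coe_nonneg
  have hgap := gap_le_one_sub_inv_pow_mul hk (f := fun i => ∑ x ∈ prefixUnion T i, (w x : ℝ))
    (c := ∑ x ∈ Finset.univ.biUnion A, (w x : ℝ)) (by simp [prefixUnion_zero])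
    (fun i hi => by
      have hsucc := prefixUnion_succ T ⟨i, hi⟩
      dsimp only at hsucc ⊢
      rw [hsucc]
      exact sum_biUnion_sub_le_mul_gain hw A _ _ fun j => hgreedy ⟨i, hi⟩ (A j) (hA j))
    k le_rfl
  simp only [prefixUnion_length] at hgap
  have hexp : (1 - 1 / (k : ℝ)) ^ k ≤ 1 / Real.exp 1 := by
    rw [one_div (Real.exp 1), ← Real.exp_neg]
    exact Real.one_sub_div_pow_le_exp_neg (by exact_mod_cast hk)
  have hmul := mul_le_mul_of_nonneg_right hexp
    (sum_nonneg fun x (_ : x ∈ Finset.univ.biUnion A) => hw x)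
  linarith
end

section
/- Let T = (V,E) be a finite tree (a finite connected acyclic simple graph) with a nonnegative vertex-weight function w : V → ℝ≥0 and total weight 𝒲 = Σ_{v∈V} w(v), and let τ ≥ 1 be an integer. Then there exists a set P ⊆ V with |P| ≤ τ such that every connected component of the subgraph of T induced on V ∖ P has total vertex weight at most 𝒲/(τ+1). -/
open Finset
open scoped Classical

namespace SimpleGraph

variable {V : Type*} {G : SimpleGraph V}

/-- In a tree, if a neighbour `c` of `v` is joined to `u` by a walk avoiding `v`, then every walk
from `v` to `u` goes through `c`. -/
theorem IsTree.mem_support_of_adj (hG : G.IsTree) {v c u : V} (h : G.Adj v c)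
    (q : G.Walk c u) (hq : v ∉ q.support) (p : G.Walk v u) : c ∈ p.support := by
  have hpath : (Walk.cons h q.bypass).IsPath :=
    (Walk.cons_isPath_iff _ _).2
      ⟨q.bypass_isPath, fun hv => hq (q.support_bypass_subset_support hv)⟩
  have heq : p.bypass = Walk.cons h q.bypass :=
    (hG.existsUnique_path v u).unique p.bypass_isPath hpath
  apply p.support_bypass_subset_support
  rw [heq, Walk.support_cons]
  exact List.mem_cons_of_mem _ q.bypass.start_mem_support

/-- In a tree rooted at `r`, if `x ≠ v` descends from `v`, then `v` has a child `c` from which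
the whole component of `x` in `G - v` descends. -/
theorem IsTree.exists_child (hG : G.IsTree) {r v x : V} (hne : x ≠ v)
    (hx : ∀ p : G.Walk r x, v ∈ p.support) :
    ∃ c, (∃ p : G.Walk r v, c ∉ p.support) ∧
      (∀ u, (∀ p : G.Walk r u, c ∈ p.support) → ∀ p : G.Walk r u, v ∈ p.support) ∧
      ∀ u (s : G.Walk x u), v ∉ s.support → ∀ p : G.Walk r u, c ∈ p.support := by
  obtain ⟨q, hq, -⟩ := hG.existsUnique_path v x
  cases q with
  | nil => exact absurd rfl hne
  | @cons _ c _ h q =>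
    have hvq := ((Walk.cons_isPath_iff _ _).1 hq).2
    have hc : ∀ p : G.Walk r c, v ∈ p.support := fun p =>
      ((Walk.mem_support_append_iff p q).1 (hx _)).resolve_right hvq
    refine ⟨c, ?_, fun u hu p => ?_, fun u s hs p => ?_⟩
    · obtain ⟨p, hp, -⟩ := hG.existsUnique_path r v
      exact ⟨p, fun hcp => Walk.endpoint_notMem_support_takeUntil hp hcp h.ne (hc _)⟩
    · exact p.support_takeUntil_subset_support (hu p) (hc _)
    · have hv : v ∈ p.support := by
        have := hx (p.append s.reverse)
        rw [Walk.mem_support_append_iff, Walk.support_reverse, List.mem_reverse] at this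
        exact this.resolve_right hs
      refine p.support_dropUntil_subset_support hv
        (hG.mem_support_of_adj h (q.append s) ?_ (p.dropUntil v hv))
      rw [Walk.mem_support_append_iff]
      exact fun h => h.elim hvq hs

/-- In a tree of total weight at most `(n + 1) * L`, some `n` vertices can be removed so that all
remaining components have weight at most `L`. -/
theorem IsTree.exists_card_le_forall_component_weight_le [Fintype V] (hG : G.IsTree)
    (L : NNReal) (n : ℕ) (w : V → NNReal) (hw : ∑ u, w u ≤ ((n : NNReal) + 1) * L) :
    ∃ P : Finset V, P.card ≤ n ∧ ∀ v, v ∉ P →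
      ∑ u ∈ Finset.univ.filter (fun u => ∃ p : G.Walk v u, ∀ x ∈ p.support, x ∉ P), w u ≤ L := by
  induction n generalizing w with
  | zero =>
    refine ⟨∅, le_rfl, fun v _ => (Finset.sum_le_univ_sum_of_nonneg fun _ => zero_le).trans ?_⟩
    simpa using hw
  | succ n ih =>
    by_cases hL : ∑ u, w u ≤ L
    · exact ⟨∅, Nat.zero_le _, fun v _ =>
        (Finset.sum_le_univ_sum_of_nonneg fun _ => zero_le).trans hL⟩
    obtain ⟨r⟩ := hG.connected.nonempty
    let D : V → Finset V := fun v => {u | ∀ p : G.Walk r u, v ∈ p.support}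
    have hD : ∀ v u, u ∈ D v ↔ ∀ p : G.Walk r u, v ∈ p.support := by simp [D]
    have hr : r ∈ ({v | L < ∑ u ∈ D v, w u} : Finset V) := by
      have : D r = Finset.univ :=
        Finset.eq_univ_of_forall fun u => (hD r u).2 fun p => p.start_mem_support
      simpa [this] using hL
    obtain ⟨v, hv, hmin⟩ := Finset.exists_min_image _ (fun v => (D v).card) ⟨r, hr⟩
    replace hv : L < ∑ u ∈ D v, w u := by simpa using hv
    have hsplit : ∑ u, (if u ∈ D v then 0 else w u) + ∑ u ∈ D v, w u = ∑ u, w u := by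
      rw [← Finset.sum_filter_add_sum_filter_not Finset.univ (· ∈ D v) w, add_comm,
        Finset.sum_ite]
      simp
    obtain ⟨P, hP, hcomp⟩ := ih (fun u => if u ∈ D v then 0 else w u) (by
      rw [← hsplit] at hw
      push_cast at hw
      have h : (∑ u, (if u ∈ D v then 0 else w u)) + L ≤ ((n : NNReal) + 1) * L + L :=
        (add_le_add_right hv.le _).trans (hw.trans_eq (by ring))
      exact le_of_add_le_add_right h)
    refine ⟨insert v P, (Finset.card_insert_le _ _).trans (by omega), fun x hx => ?_⟩
    have hxv : x ≠ v := fun h => hx (by simp [h])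
    have hxP : x ∉ P := fun h => hx (by simp [h])
    by_cases hxD : x ∈ D v
    · obtain ⟨c, ⟨p, hp⟩, hcv, hc⟩ := hG.exists_child hxv ((hD v x).1 hxD)
      have hlt : (D c).card < (D v).card := by
        refine Finset.card_lt_card ⟨fun u hu => (hD v u).2 (hcv u ((hD c u).1 hu)), fun hsub => ?_⟩
        exact hp ((hD c v).1 (hsub ((hD v v).2 fun p => p.end_mem_support)) p)
      have hcL : ∑ u ∈ D c, w u ≤ L := by
        by_contra! hcL
        exact hlt.not_ge (hmin c (by simpa using hcL))
      refine (Finset.sum_le_sum_of_subset fun u hu => ?_).trans hcL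
      obtain ⟨s, hs⟩ := (Finset.mem_filter.1 hu).2
      exact (hD c u).2 (hc u s fun h => hs v h (Finset.mem_insert_self _ _))
    · refine le_trans ?_ (hcomp x hxP)
      obtain ⟨p, hp⟩ := not_forall.1 (mt (hD v x).2 hxD)
      have hout : ∀ u ∈ Finset.univ.filter
          (fun u => ∃ p : G.Walk x u, ∀ y ∈ p.support, y ∉ insert v P), u ∉ D v := by
        intro u hu huD
        obtain ⟨s, hs⟩ := (Finset.mem_filter.1 hu).2
        rcases (Walk.mem_support_append_iff p s).1 ((hD v u).1 huD (p.append s)) with h | h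
        · exact hp h
        · exact hs v h (Finset.mem_insert_self _ _)
      rw [Finset.sum_congr rfl fun u hu => (if_neg (hout u hu)).symm]
      refine Finset.sum_le_sum_of_subset fun u hu => ?_
      obtain ⟨s, hs⟩ := (Finset.mem_filter.1 hu).2
      exact Finset.mem_filter.2
        ⟨Finset.mem_univ _, s, fun y hy h => hs y hy (Finset.mem_insert_of_mem h)⟩

end SimpleGraph

/-- **Lemma 4 of the paper (vertex-weighted case).**
For any finite tree `G` with nonnegative vertex weights `w` of total weight `𝒲` and any
integer `τ ≥ 1`, there is a set `P` of at most `τ` vertices such that every connected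
component of the subgraph induced on the complement of `P` has total weight at most
`𝒲 / (τ + 1)`.  The component of a vertex `v ∉ P` consists of the vertices
reachable from `v` by a walk avoiding `P`. -/
theorem tree_balanced_partition
    {V : Type*} [Fintype V] (G : SimpleGraph V) (hG : G.IsTree)
    (w : V → NNReal) (τ : ℕ) (hτ : 1 ≤ τ) :
    ∃ P : Finset V, P.card ≤ τ ∧
      ∀ v : V, v ∉ P →
        (∑ u ∈ Finset.univ.filter
            (fun u => ∃ p : G.Walk v u, ∀ x ∈ p.support, x ∉ P), w u) ≤
          (∑ u : V, w u) / ((τ : NNReal) + 1) := by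
  exact hG.exists_card_le_forall_component_weight_le _ τ w (mul_div_cancel₀ _ (by positivity)).ge
end

section
/- Let T = (V,E) be a finite tree (a finite connected acyclic simple graph) with a nonnegative vertex-weight function w : V → ℝ≥0 and total weight 𝒲 = Σ_{v∈V} w(v), and let τ ≥ 1 be an integer. Then there exists a vertex v ∈ V such that, among the connected components of the subgraph induced on V ∖ {v}, every component has total weight at most τ·𝒲/(τ+1), and at most one component has total weight exceeding 𝒲/(τ+1). -/
open Finset
open scoped Classical

/-- The total weight of the connected component containing `u` in the subgraph of `G`
induced on the complement of `{v}`: the sum of `w` over all vertices reachable from `u`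
by a walk avoiding `v`. -/
noncomputable def compWeight {V : Type*} [Fintype V] (G : SimpleGraph V)
    (w : V → NNReal) (v u : V) : NNReal :=
  ∑ x ∈ Finset.univ.filter (fun x => ∃ p : G.Walk u x, ∀ y ∈ p.support, y ≠ v), w x

namespace SimpleGraph

variable {V : Type*} {G : SimpleGraph V}

/-- `a` and `b` are joined by a walk of `G` that avoids the vertex `v`. -/
def ReachableAvoiding (G : SimpleGraph V) (v a b : V) : Prop :=
  ∃ p : G.Walk a b, ∀ y ∈ p.support, y ≠ v

namespace ReachableAvoiding

theorem symm {v a b : V} (h : G.ReachableAvoiding v a b) : G.ReachableAvoiding v b a := by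
  obtain ⟨p, hp⟩ := h
  exact ⟨p.reverse, by simpa using hp⟩

theorem trans {v a b c : V} (h₁ : G.ReachableAvoiding v a b)
    (h₂ : G.ReachableAvoiding v b c) : G.ReachableAvoiding v a c := by
  obtain ⟨p, hp⟩ := h₁
  obtain ⟨q, hq⟩ := h₂
  refine ⟨p.append q, fun y hy => ?_⟩
  rcases (Walk.mem_support_append_iff p q).1 hy with h | h
  exacts [hp y h, hq y h]

theorem ne_right {v a b : V} (h : G.ReachableAvoiding v a b) : b ≠ v := by
  obtain ⟨p, hp⟩ := h
  exact hp b p.end_mem_support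

theorem ne_left {v a b : V} (h : G.ReachableAvoiding v a b) : a ≠ v :=
  h.symm.ne_right

end ReachableAvoiding

/-- In an acyclic graph, a vertex `x` on the far side of `c` from its neighbour `v` cannot be
reached from `v` avoiding `c`. -/
theorem IsAcyclic.not_reachableAvoiding_of_adj (hG : G.IsAcyclic) {v c x : V} (hvc : G.Adj v c)
    (hx : G.ReachableAvoiding v c x) : ¬ G.ReachableAvoiding c v x := by
  rintro ⟨q, hq⟩
  obtain ⟨p, hp⟩ := hx
  have hv : v ∉ p.bypass.support := fun h => hp v (p.support_bypass_subset_support h) rfl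
  have heq : Walk.cons hvc p.bypass = q.bypass :=
    congrArg Subtype.val ((hG.subsingleton_path v x).elim
      ⟨.cons hvc p.bypass, p.bypass_isPath.cons hv⟩ ⟨q.bypass, q.bypass_isPath⟩)
  have hc : c ∈ q.bypass.support := by
    rw [← heq]
    simp
  exact hq c (q.support_bypass_subset_support hc) rfl

/-- The vertices separated from the root `r` by `v`; in a tree, these are the descendants of `v`,
including `v` itself. -/
noncomputable def descendants [Fintype V] (G : SimpleGraph V) (r v : V) : Finset V :=
  Finset.univ.filter fun x => ¬ G.ReachableAvoiding v r x

variable [Fintype V]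

theorem mem_descendants {r v x : V} :
    x ∈ G.descendants r v ↔ ¬ G.ReachableAvoiding v r x := by
  simp [descendants]

theorem descendants_self (r : V) : G.descendants r r = Finset.univ := by
  ext x
  simpa [mem_descendants] using fun h : G.ReachableAvoiding r r x => h.ne_left rfl

/-- The component, after deletion of `v`, of a proper descendant `u` of `v` lies among the
descendants of a child of `v`. -/
theorem IsTree.exists_descendants_ssubset (hG : G.IsTree) {r v u : V} (huv : u ≠ v)
    (hu : u ∈ G.descendants r v) :
    ∃ c, G.descendants r c ⊂ G.descendants r v ∧
      ∀ x, G.ReachableAvoiding v u x → x ∈ G.descendants r c := by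
  obtain ⟨q, hq, -⟩ := hG.existsUnique_path v u
  cases q with
  | nil => exact absurd rfl huv
  | @cons _ c _ hvc p =>
    have hcu : G.ReachableAvoiding v c u :=
      ⟨p, fun y hy hyv => ((Walk.cons_isPath_iff hvc p).1 hq).2 (hyv ▸ hy)⟩
    rw [mem_descendants] at hu
    have hc : ¬ G.ReachableAvoiding v r c := fun h => hu (h.trans hcu)
    refine ⟨c, (Finset.ssubset_iff_of_subset fun x hx => ?_).2 ⟨v, ?_, ?_⟩, fun x hx => ?_⟩
    · rw [mem_descendants] at hx ⊢
      rintro ⟨s, hs⟩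
      refine hx ⟨s, fun y hy hyc => ?_⟩
      subst hyc
      exact hc ⟨s.takeUntil y hy, fun z hz => hs z (s.support_takeUntil_subset_support hy hz)⟩
    · exact mem_descendants.2 fun h => h.ne_right rfl
    · rw [mem_descendants, not_not]
      obtain ⟨s, hs, -⟩ := hG.existsUnique_path r v
      refine ⟨s, fun y hy hyc => ?_⟩
      subst hyc
      refine hc ⟨s.takeUntil y hy, fun z hz hzv => ?_⟩
      subst hzv
      exact Walk.endpoint_notMem_support_takeUntil hs hy hvc.ne hz
    · rw [mem_descendants]
      rintro ⟨s, hs⟩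
      have hv : v ∈ s.support := by
        by_contra hv
        exact hu (ReachableAvoiding.trans ⟨s, fun y hy hyv => hv (hyv ▸ hy)⟩ hx.symm)
      exact hG.isAcyclic.not_reachableAvoiding_of_adj hvc (hcu.trans hx)
        ⟨s.dropUntil v hv, fun z hz => hs z (s.support_dropUntil_subset_support hv hz)⟩

end SimpleGraph

open SimpleGraph in
theorem compWeight_le_sum {V : Type*} [Fintype V] {G : SimpleGraph V} (w : V → NNReal) {v u : V}
    {s : Finset V} (h : ∀ x, G.ReachableAvoiding v u x → x ∈ s) :
    compWeight G w v u ≤ ∑ x ∈ s, w x :=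
  Finset.sum_le_sum_of_subset fun x hx => h x (Finset.mem_filter.1 hx).2

/-- Some vertex `v` of a rooted tree has descendants of total weight at least `t`, while every
component of proper descendants of `v` weighs less than `t`. -/
theorem SimpleGraph.IsTree.exists_le_sum_descendants {V : Type*} [Fintype V] {G : SimpleGraph V}
    (hG : G.IsTree) (w : V → NNReal) (r : V) {t : NNReal} (ht : t ≤ ∑ x, w x) :
    ∃ v, t ≤ ∑ x ∈ G.descendants r v, w x ∧
      ∀ u, u ≠ v → u ∈ G.descendants r v → compWeight G w v u < t := by
  obtain ⟨v, hv, hmin⟩ := (Finset.univ.filter fun v => t ≤ ∑ x ∈ G.descendants r v, w x)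
    |>.exists_min_image (fun v => (G.descendants r v).card)
      ⟨r, by simpa [SimpleGraph.descendants_self] using ht⟩
  refine ⟨v, (Finset.mem_filter.1 hv).2, fun u huv hu => ?_⟩
  obtain ⟨c, hcv, hc⟩ := hG.exists_descendants_ssubset huv hu
  refine (compWeight_le_sum w hc).trans_lt (lt_of_not_ge fun h => ?_)
  exact (Finset.card_lt_card hcv).not_ge (hmin c (Finset.mem_filter.2 ⟨Finset.mem_univ c, h⟩))

/-- **Single-cut-point step in the proof of Lemma 4 of the paper (vertex-weighted
case).**  For any finite tree `G` with nonnegative vertex weights `w` of total weight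
`𝒲` and any integer `τ ≥ 1`, there is a vertex `v` whose removal leaves components all
of weight at most `τ·𝒲/(τ+1)`, at most one of which has weight exceeding `𝒲/(τ+1)`
(any two vertices lying in components of weight `> 𝒲/(τ+1)` are in the same component,
i.e. joined by a walk avoiding `v`). -/
theorem tree_exists_centroid_cut
    {V : Type*} [Fintype V] (G : SimpleGraph V) (hG : G.IsTree)
    (w : V → NNReal) (τ : ℕ) (hτ : 1 ≤ τ) :
    ∃ v : V,
      (∀ u : V, u ≠ v →
        compWeight G w v u ≤ (τ : NNReal) * (∑ x : V, w x) / ((τ : NNReal) + 1)) ∧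
      (∀ u₁ u₂ : V, u₁ ≠ v → u₂ ≠ v →
        (∑ x : V, w x) / ((τ : NNReal) + 1) < compWeight G w v u₁ →
        (∑ x : V, w x) / ((τ : NNReal) + 1) < compWeight G w v u₂ →
        ∃ p : G.Walk u₁ u₂, ∀ y ∈ p.support, y ≠ v) := by
  obtain ⟨r⟩ := hG.connected.nonempty
  set W := ∑ x : V, w x
  have hsplit : (τ : NNReal) * W / (τ + 1) + W / (τ + 1) = W := by field_simp
  obtain ⟨v, hv, hlight⟩ := hG.exists_le_sum_descendants w r
    (t := W / (τ + 1)) (le_add_self.trans_eq hsplit)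
  have hreach : ∀ u, u ≠ v → W / (τ + 1) < compWeight G w v u → G.ReachableAvoiding v r u := by
    intro u huv hu
    by_contra h
    exact hu.not_gt (hlight u huv (SimpleGraph.mem_descendants.2 h))
  refine ⟨v, fun u huv => ?_, fun u₁ u₂ h₁ h₂ hu₁ hu₂ =>
    (hreach u₁ h₁ hu₁).symm.trans (hreach u₂ h₂ hu₂)⟩
  by_cases hu : W / (τ + 1) < compWeight G w v u
  · have hle : compWeight G w v u ≤ ∑ x ∈ (G.descendants r v)ᶜ, w x :=
      compWeight_le_sum w fun x hx => by
        simpa [SimpleGraph.mem_descendants] using (hreach u huv hu).trans hx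
    have hsum : ∑ x ∈ (G.descendants r v)ᶜ, w x + ∑ x ∈ G.descendants r v, w x = W :=
      Finset.sum_compl_add_sum _ _
    refine hle.trans (le_of_add_le_add_right (a := W / (τ + 1)) ?_)
    rw [hsplit]
    exact (add_le_add le_rfl hv).trans_eq hsum
  · refine (not_lt.1 hu).trans ?_
    gcongr
    exact le_mul_of_one_le_left' (by exact_mod_cast hτ)
end

section
/- Let G = (V,E) be a finite tree with a nonnegative vertex-weight function w : V → ℝ≥0 and total weight 𝒲 = Σ_{v∈V} w(v), and let m ≥ k ≥ 1 be integers with m ≤ |V|. Then there exists a set F ⊆ V with |F| ≤ m such that for every set S ⊆ V disjoint from F with |S| ≤ k, Player 2's payoff satisfies Q2(F,S) ≤ k·𝒲/(m+1); equivalently, Player 1's payoff 𝒲 − Q2(F,S) is at least ((m−k+1)/(m+1))·𝒲. -/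
open Finset
open scoped Classical

/-- If `u` and `v` are both neighbours of `x` in a tree and neither is farther from `r` than `x`,
they coincide. -/
lemma SimpleGraph.IsTree.eq_of_adj_of_dist_le {V : Type*} {G : SimpleGraph V} (hG : G.IsTree)
    {r x u v : V} (hu : G.Adj x u) (hv : G.Adj x v) (hur : G.dist r u ≤ G.dist r x)
    (hvr : G.dist r v ≤ G.dist r x) : u = v := by
  have key : ∀ y, G.Adj x y → G.dist r y ≤ G.dist r x →
      ∃ p : G.Walk x r, p.IsPath ∧ p.snd = y := by
    intro y hy hle
    obtain ⟨q, hq⟩ := hG.connected.exists_walk_length_eq_dist y r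
    refine ⟨.cons hy q, SimpleGraph.Walk.isPath_of_length_eq_dist _ ?_, by simp⟩
    have := hG.dist_eq_dist_add_one_of_adj r hy
    rw [SimpleGraph.Walk.length_cons, hq, G.dist_comm (u := y), G.dist_comm (u := x)]
    omega
  obtain ⟨p, hp, rfl⟩ := key u hu hur
  obtain ⟨q, hq, rfl⟩ := key v hv hvr
  have := (hG.isAcyclic.subsingleton_path x r).elim ⟨p, hp⟩ ⟨q, hq⟩
  rw [Subtype.mk.injEq] at this
  rw [this]

/-- In a tree, one can delete a set `F` of vertices with `#F * t` less than the total weight (or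
`F = ∅`) so that the remaining vertices of `A` carry a labelling which is constant along edges and
each of whose classes has weight at most `t`. -/
lemma SimpleGraph.IsTree.exists_separator_labelling {V : Type*} {G : SimpleGraph V}
    (hG : G.IsTree) (r : V) (t : NNReal) (A : Finset V) :
    ∀ w : V → NNReal, ∃ F : Finset V, ∃ c : V → V,
      F ⊆ A ∧ (F = ∅ ∨ (#F : NNReal) * t < ∑ v ∈ A, w v) ∧ (∀ v ∈ A, c v ∈ A) ∧
      (∀ u ∈ A, ∀ v ∈ A, u ∉ F → v ∉ F → G.Adj u v → c u = c v) ∧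
      ∀ a, (∑ v ∈ A, if v ∉ F ∧ c v = a then w v else 0) ≤ t := by
  induction A using Finset.induction_on_max_value (G.dist r) with
  | empty => exact fun w => ⟨∅, id, by simp⟩
  | insert l A hl hmax ih =>
    intro w
    have isolated : ∀ w' : V → NNReal, (∀ v, w v ≤ w' v) → ∑ v ∈ A, w' v ≤ w l + ∑ v ∈ A, w v →
        w l ≤ t → ∀ F : Finset V, ∀ c : V → V, F ⊆ A →
        (F = ∅ ∨ (#F : NNReal) * t < ∑ v ∈ A, w' v) → (∀ v ∈ A, c v ∈ A) →
        (∀ u ∈ A, ∀ v ∈ A, u ∉ F → v ∉ F → G.Adj u v → c u = c v) →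
        (∀ a, (∑ v ∈ A, if v ∉ F ∧ c v = a then w' v else 0) ≤ t) →
        (∀ v ∈ A, G.Adj l v → v ∈ F) → ∃ F : Finset V, ∃ c : V → V,
        F ⊆ insert l A ∧ (F = ∅ ∨ (#F : NNReal) * t < ∑ v ∈ insert l A, w v) ∧
        (∀ v ∈ insert l A, c v ∈ insert l A) ∧
        (∀ u ∈ insert l A, ∀ v ∈ insert l A, u ∉ F → v ∉ F → G.Adj u v → c u = c v) ∧
        ∀ a, (∑ v ∈ insert l A, if v ∉ F ∧ c v = a then w v else 0) ≤ t := by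
      intro w' hw hsum hlt F c hFA hF hcA hc hct hadj
      refine ⟨F, Function.update c l l, hFA.trans (subset_insert _ _), ?_, ?_, ?_, ?_⟩
      · rw [sum_insert hl]
        exact hF.imp_right fun h => h.trans_le hsum
      · grind
      · intro u hu v hv huF hvF huv
        have := huv.symm
        have := huv.ne
        grind
      · intro a
        rw [sum_insert hl]
        by_cases ha : a = l
        · subst ha
          rw [sum_eq_zero, add_zero]
          · split_ifs
            · exact hlt
            · exact zero_le
          · grind
        · rw [if_neg (by simp [Ne.symm ha]), zero_add]
          refine le_trans (sum_le_sum fun v hv => ?_) (hct a)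
          have : v ≠ l := by grind
          rw [Function.update_of_ne this]
          split_ifs
          · exact hw v
          · exact le_rfl
    rcases lt_or_ge t (w l) with hlt | hlt
    · obtain ⟨F, c, hFA, hF, hcA, hc, hct⟩ := ih w
      refine ⟨insert l F, Function.update c l l, insert_subset_insert _ hFA, Or.inr ?_, ?_, ?_, ?_⟩
      · rw [card_insert_of_notMem fun h => hl (hFA h), sum_insert hl]
        push_cast
        rw [add_mul, one_mul, add_comm]
        refine add_lt_add_of_lt_of_le hlt ?_
        rcases hF with rfl | hF
        · simp
        · exact hF.le
      · grind
      · grind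
      · intro a
        rw [sum_insert hl, if_neg (by simp), zero_add]
        refine le_trans (le_of_eq (sum_congr rfl fun v hv => ?_)) (hct a)
        have : v ≠ l := by grind
        simp [this]
    · by_cases hp : ∃ p ∈ A, G.Adj l p
      · obtain ⟨p, hpA, hlp⟩ := hp
        have huniq : ∀ v ∈ A, G.Adj l v → v = p := fun v hv hlv =>
          hG.eq_of_adj_of_dist_le hlv hlp (hmax v hv) (hmax p hpA)
        have hsum : ∑ v ∈ A, (w v + if v = p then w l else 0) = w l + ∑ v ∈ A, w v := by
          rw [sum_add_distrib, sum_ite_eq' A p, if_pos hpA, add_comm]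
        obtain ⟨F, c, hFA, hF, hcA, hc, hct⟩ := ih fun v => w v + if v = p then w l else 0
        by_cases hpF : p ∈ F
        · exact isolated _ (fun v => le_self_add) hsum.le hlt F c hFA hF hcA hc hct
            fun v hv hlv => huniq v hv hlv ▸ hpF
        · refine ⟨F, Function.update c l (c p), hFA.trans (subset_insert _ _), ?_, ?_, ?_, ?_⟩
          · rw [sum_insert hl, ← hsum]
            exact hF
          · grind
          · intro u hu v hv huF hvF huv
            have := huv.symm
            have := huv.ne
            grind
          · intro a
            refine le_trans (le_of_eq ?_) (hct a)
            have hlF : l ∉ F := fun h => hl (hFA h)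
            have hsplit : ∀ v ∈ A, (if v ∉ F ∧ c v = a then w v + (if v = p then w l else 0) else 0)
                = (if v ∉ F ∧ c v = a then w v else 0) +
                  if v = p then (if c p = a then w l else 0) else 0 := by
              intro v hv
              by_cases hvp : v = p
              · subst hvp
                by_cases hca : c v = a <;> simp [hpF, hca]
              · simp [hvp]
            rw [sum_congr rfl hsplit, sum_add_distrib, sum_ite_eq' A p, if_pos hpA, sum_insert hl,
              add_comm]
            congr 1
            · refine sum_congr rfl fun v hv => ?_
              have : v ≠ l := by grind
              simp [this]
            · simp [hlF]
      · obtain ⟨F, c, hFA, hF, hcA, hc, hct⟩ := ih w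
        exact isolated w (fun _ => le_rfl) le_add_self hlt F c hFA hF hcA hc hct
          fun v hv hlv => (hp ⟨v, hv, hlv⟩).elim

/-- A labelling that is constant along edges avoiding `F` is constant along walks avoiding `F`. -/
lemma SimpleGraph.Walk.apply_eq_of_forall_notMem {V α : Type*} {G : SimpleGraph V} {F : Finset V}
    {c : V → α} (hc : ∀ u v, u ∉ F → v ∉ F → G.Adj u v → c u = c v) {x y : V} (p : G.Walk x y)
    (hp : ∀ v ∈ p.support, v ∉ F) : c x = c y := by
  induction p with
  | nil => rfl
  | cons h q ih =>
    simp only [SimpleGraph.Walk.support_cons, List.mem_cons, forall_eq_or_imp] at hp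
    exact (hc _ _ hp.1 (hp.2 _ q.start_mem_support) h).trans (ih hp.2)

/-- If no vertex of `F` is strictly closer to `v` than `s ∉ F`, a shortest walk from `v` to `s`
avoids `F`. -/
lemma SimpleGraph.Walk.notMem_of_mem_support_of_dist_le {V : Type*} {G : SimpleGraph V}
    {F : Finset V} {v s : V} (hs : s ∉ F) (hle : ∀ f ∈ F, G.dist v s ≤ G.dist v f)
    (p : G.Walk v s) (hp : p.length = G.dist v s) : ∀ x ∈ p.support, x ∉ F := by
  intro x hx hxF
  have hxs : x ≠ s := fun h => hs (h ▸ hxF)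
  have h₁ := SimpleGraph.Walk.length_takeUntil_lt_length hx hxs
  have h₂ := SimpleGraph.dist_le (p.takeUntil x hx)
  have h₃ := hle x hxF
  omega

/-- **Corollary 1 of the paper (discrete-vertex analogue).**
In the one-round `(m,k)` Voronoi game on a finite tree `G` with nonnegative vertex
weights `w` of total weight `𝒲`, where `m ≥ k ≥ 1` and `m ≤ |V|`, Player 1 has a
placement `F` of at most `m` facilities such that for every placement `S` of at most
`k` facilities of Player 2 disjoint from `F`, Player 2's payoff — the total weight of
the vertices `v` with `d(v,S) ≤ d(v,F)` (ties favor Player 2) — is at most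
`k · 𝒲 / (m + 1)`; equivalently, Player 1's payoff is at least
`((m − k + 1)/(m + 1)) · 𝒲`. -/
theorem player_one_guarantee_on_tree
    {V : Type*} [Fintype V] (G : SimpleGraph V) (hG : G.IsTree)
    (w : V → NNReal) (m k : ℕ) (hk : 1 ≤ k) (hkm : k ≤ m)
    (hm : m ≤ Fintype.card V) :
    ∃ F : Finset V, F.card ≤ m ∧
      ∀ S : Finset V, (∀ x ∈ S, x ∉ F) → S.card ≤ k →
        (∑ v ∈ Finset.univ.filter
            (fun v => (S.inf fun s => (G.dist v s : ℕ∞)) ≤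
              (F.inf fun f => (G.dist v f : ℕ∞))), w v) ≤
          (k : NNReal) * (∑ v : V, w v) / ((m : NNReal) + 1) := by
  obtain ⟨r⟩ := hG.connected.nonempty
  set t : NNReal := (∑ v : V, w v) / ((m : NNReal) + 1) with ht
  have hW : ∑ v : V, w v = ((m : NNReal) + 1) * t := by
    rw [ht, mul_div_cancel₀ _ (by positivity)]
  obtain ⟨F, c, -, hF, -, hc, hct⟩ := hG.exists_separator_labelling r t univ w
  have hc' : ∀ u v, u ∉ F → v ∉ F → G.Adj u v → c u = c v := fun u v =>
    hc u (mem_univ _) v (mem_univ _)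
  refine ⟨F, ?_, fun S hSF hS => ?_⟩
  · rcases hF with rfl | hF
    · simp
    · rw [hW] at hF
      have := lt_of_mul_lt_mul_right hF zero_le
      exact Nat.lt_succ_iff.mp (by exact_mod_cast this)
  rw [mul_div_assoc, ← ht]
  rcases F.eq_empty_or_nonempty with rfl | ⟨f₀, hf₀⟩
  · calc _ ≤ ∑ v : V, w v := sum_le_sum_of_subset (filter_subset _ _)
      _ = ∑ v : V, if v ∉ (∅ : Finset V) ∧ c v = c r then w v else 0 := by
        refine sum_congr rfl fun v _ => ?_
        obtain ⟨p⟩ := hG.connected v r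
        simp [p.apply_eq_of_forall_notMem hc' (by simp)]
      _ ≤ t := hct _
      _ ≤ k * t := le_mul_of_one_le_left zero_le (by exact_mod_cast hk)
  · have hserved : ∀ v, (S.inf fun s => (G.dist v s : ℕ∞)) ≤ (F.inf fun f => (G.dist v f : ℕ∞)) →
        ∃ s ∈ S, v ∉ F ∧ c v = c s := by
      intro v hv
      have hSne : S.Nonempty := by
        by_contra h
        rw [not_nonempty_iff_eq_empty.mp h, inf_empty, top_le_iff] at hv
        have := inf_le (f := fun f => (G.dist v f : ℕ∞)) hf₀
        simp [hv] at this
      obtain ⟨s, hs, hmin⟩ := exists_mem_eq_inf S hSne fun s => (G.dist v s : ℕ∞)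
      have hle : ∀ f ∈ F, G.dist v s ≤ G.dist v f := fun f hf => by
        have := (hmin ▸ hv).trans (inf_le (f := fun f => (G.dist v f : ℕ∞)) hf)
        exact_mod_cast this
      obtain ⟨p, hp⟩ := hG.connected.exists_walk_length_eq_dist v s
      have hpF := p.notMem_of_mem_support_of_dist_le (hSF s hs) hle hp
      exact ⟨s, hs, hpF v p.start_mem_support, p.apply_eq_of_forall_notMem hc' hpF⟩
    calc _ ≤ ∑ v : V, ∑ s ∈ S, (if v ∉ F ∧ c v = c s then w v else 0) := by
          rw [sum_filter]
          refine sum_le_sum fun v _ => ?_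
          split_ifs with hv
          · obtain ⟨s, hs, hvs⟩ := hserved v hv
            exact (if_pos hvs).ge.trans
              (single_le_sum (f := fun s => if v ∉ F ∧ c v = c s then w v else 0)
                (fun _ _ => zero_le) hs)
          · exact zero_le
      _ = ∑ s ∈ S, ∑ v : V, (if v ∉ F ∧ c v = c s then w v else 0) := sum_comm
      _ ≤ ∑ s ∈ S, t := sum_le_sum fun s _ => hct _
      _ = #S * t := by rw [sum_const, nsmul_eq_mul]
      _ ≤ k * t := by gcongr
end
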